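/- For the metric g determined by the real constants a, b, p, q, s, the Weyl tensor has nonzero components (up to the symmetries of the curvature tensor) exactly W₂₄₂₄ = −W₃₄₃₄ = ((b − a)x⁴ + s − p)/2 and W₂₄₃₄ = −q; all components not obtained from these by the curvature symmetries vanish identically. -/

import Mathlib

noncomputable section

open scoped BigOperators

/-- The metric of a four-dimensional two-symmetric Lorentzian manifold, in
coordinates `x 0 = x¹, x 1 = x², x 2 = x³, x 3 = x⁴`:
`g₁₄ = g₄₁ = g₂₂ = g₃₃ = 1`,
`g₄₄ = x⁴(a(x²)² + b(x³)²) + p(x²)² + 2q x²x³ + s(x³)²`, all others zero. -/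
def gmat (a b p q s : ℝ) (x : Fin 4 → ℝ) : Matrix (Fin 4) (Fin 4) ℝ :=
  Matrix.of fun i j =>
    if i = 0 ∧ j = 3 then 1
    else if i = 3 ∧ j = 0 then 1
    else if i = 1 ∧ j = 1 then 1
    else if i = 2 ∧ j = 2 then 1
    else if i = 3 ∧ j = 3 then
      x 3 * (a * (x 1) ^ 2 + b * (x 2) ^ 2) + p * (x 1) ^ 2
        + 2 * q * x 1 * x 2 + s * (x 2) ^ 2
    else 0

/-- The inverse matrix `g^{ij}`. -/
def ginv (a b p q s : ℝ) (x : Fin 4 → ℝ) : Matrix (Fin 4) (Fin 4) ℝ :=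
  (gmat a b p q s x)⁻¹

/-- Partial derivative `∂_i` of a function on ℝ⁴. -/
def pd (i : Fin 4) (f : (Fin 4 → ℝ) → ℝ) (x : Fin 4 → ℝ) : ℝ :=
  fderiv ℝ f x (Pi.single i 1)

/-- Christoffel symbols `Γ^k_{ij} = (1/2) Σ_l g^{kl}(∂_i g_{jl} + ∂_j g_{il} − ∂_l g_{ij})`. -/
def Gam (a b p q s : ℝ) (k i j : Fin 4) (x : Fin 4 → ℝ) : ℝ :=
  (1 / 2) * ∑ l, ginv a b p q s x k l *
    (pd i (fun y => gmat a b p q s y j l) x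
      + pd j (fun y => gmat a b p q s y i l) x
      - pd l (fun y => gmat a b p q s y i j) x)

/-- Curvature tensor
`R^i_{jkl} = ∂_k Γ^i_{lj} − ∂_l Γ^i_{kj} + Σ_m (Γ^i_{km} Γ^m_{lj} − Γ^i_{lm} Γ^m_{kj})`. -/
def Riem (a b p q s : ℝ) (i j k l : Fin 4) (x : Fin 4 → ℝ) : ℝ :=
  pd k (Gam a b p q s i l j) x - pd l (Gam a b p q s i k j) x
    + ∑ m, (Gam a b p q s i k m x * Gam a b p q s m l j x
      - Gam a b p q s i l m x * Gam a b p q s m k j x)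

/-- Ricci tensor `ρ_{jl} = Σ_i R^i_{jil}`. -/
def Ric (a b p q s : ℝ) (j l : Fin 4) (x : Fin 4 → ℝ) : ℝ :=
  ∑ i, Riem a b p q s i j i l x

/-- Lowered curvature tensor `R_{ijkh} = Σ_m g_{im} R^m_{jkh}`. -/
def Rlow (a b p q s : ℝ) (i j k h : Fin 4) (x : Fin 4 → ℝ) : ℝ :=
  ∑ m, gmat a b p q s x i m * Riem a b p q s m j k h x

/-- Scalar curvature `τ = Σ_{j,l} g^{jl} ρ_{jl}`. -/
def scal (a b p q s : ℝ) (x : Fin 4 → ℝ) : ℝ :=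
  ∑ j, ∑ l, ginv a b p q s x j l * Ric a b p q s j l x

/-- Weyl tensor `W_{ijkh} = R_{ijkh} − (1/2)(g_{ik}ρ_{jh} + g_{jh}ρ_{ik} − g_{ih}ρ_{jk} − g_{jk}ρ_{ih})
+ (τ/6)(g_{ik}g_{jh} − g_{ih}g_{jk})`. -/
def Weyl (a b p q s : ℝ) (i j k h : Fin 4) (x : Fin 4 → ℝ) : ℝ :=
  Rlow a b p q s i j k h x
    - (1 / 2) * (gmat a b p q s x i k * Ric a b p q s j h x
      + gmat a b p q s x j h * Ric a b p q s i k x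
      - gmat a b p q s x i h * Ric a b p q s j k x
      - gmat a b p q s x j k * Ric a b p q s i h x)
    + (scal a b p q s x / 6) * (gmat a b p q s x i k * gmat a b p q s x j h
      - gmat a b p q s x i h * gmat a b p q s x j k)

/-- The component `g₄₄` of the metric. -/
def g44 (a b p q s : ℝ) (x : Fin 4 → ℝ) : ℝ :=
  x 3 * (a * (x 1) ^ 2 + b * (x 2) ^ 2) + p * (x 1) ^ 2 + 2 * q * x 1 * x 2 + s * (x 2) ^ 2

/-- Half the gradient of `g₄₄`. -/
def halfGrad (a b p q s : ℝ) (i : Fin 4) (x : Fin 4 → ℝ) : ℝ :=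
  ![0, x 3 * a * x 1 + p * x 1 + q * x 2, x 3 * b * x 2 + q * x 1 + s * x 2,
    (a * x 1 ^ 2 + b * x 2 ^ 2) / 2] i

/-- Half the Hessian of `g₄₄`. -/
def halfHess (a b p q s : ℝ) (x : Fin 4 → ℝ) : Matrix (Fin 4) (Fin 4) ℝ :=
  !![0, 0, 0, 0;
    0, x 3 * a + p, q, a * x 1;
    0, q, x 3 * b + s, b * x 2;
    0, a * x 1, b * x 2, 0]

lemma pd_const (i : Fin 4) (c : ℝ) (x : Fin 4 → ℝ) : pd i (fun _ => c) x = 0 := by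
  simp [pd]

lemma pd_coord (i j : Fin 4) (x : Fin 4 → ℝ) :
    pd i (fun y => y j) x = if j = i then 1 else 0 := by
  have h : HasFDerivAt (fun y : Fin 4 → ℝ => y j)
      (ContinuousLinearMap.proj (R := ℝ) (φ := fun _ : Fin 4 => ℝ) j) x :=
    hasFDerivAt_apply j x
  simp [pd, h.fderiv, Pi.single_apply]

lemma pd_add (i : Fin 4) {f g : (Fin 4 → ℝ) → ℝ} {x : Fin 4 → ℝ}
    (hf : DifferentiableAt ℝ f x) (hg : DifferentiableAt ℝ g x) :
    pd i (fun y => f y + g y) x = pd i f x + pd i g x := by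
  simp [pd, fderiv_fun_add hf hg]

lemma pd_mul (i : Fin 4) {f g : (Fin 4 → ℝ) → ℝ} {x : Fin 4 → ℝ}
    (hf : DifferentiableAt ℝ f x) (hg : DifferentiableAt ℝ g x) :
    pd i (fun y => f y * g y) x = f x * pd i g x + g x * pd i f x := by
  simp [pd, fderiv_fun_mul hf hg]

lemma pd_g44 (a b p q s : ℝ) (i : Fin 4) (x : Fin 4 → ℝ) :
    pd i (g44 a b p q s) x = 2 * halfGrad a b p q s i x := by
  change pd i (fun y => g44 a b p q s y) x = _
  simp only [g44, pow_two]
  simp (disch := fun_prop) only [pd_add, pd_mul, pd_const, pd_coord]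
  fin_cases i <;> simp [halfGrad] <;> ring

lemma differentiable_halfGrad (a b p q s : ℝ) (i : Fin 4) :
    Differentiable ℝ (halfGrad a b p q s i) := by
  change Differentiable ℝ (fun y => halfGrad a b p q s i y)
  fin_cases i <;> simp [halfGrad] <;> fun_prop

lemma pd_halfGrad (a b p q s : ℝ) (i j : Fin 4) (x : Fin 4 → ℝ) :
    pd i (halfGrad a b p q s j) x = halfHess a b p q s x i j := by
  change pd i (fun y => halfGrad a b p q s j y) x = _
  fin_cases j <;>
    simp only [halfGrad, pow_two, Fin.zero_eta, Fin.mk_one, Fin.reduceFinMk,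
      Matrix.cons_val, div_eq_mul_inv] <;>
    simp (disch := fun_prop) only [pd_add, pd_mul, pd_const, pd_coord] <;>
    fin_cases i <;> simp [halfHess] <;> ring

lemma gmat_eq (a b p q s : ℝ) (x : Fin 4 → ℝ) :
    gmat a b p q s x = !![0, 0, 0, 1; 0, 1, 0, 0; 0, 0, 1, 0; 1, 0, 0, g44 a b p q s x] := by
  ext i j
  fin_cases i <;> fin_cases j <;> simp [gmat, g44]

lemma ginv_eq (a b p q s : ℝ) (x : Fin 4 → ℝ) :
    ginv a b p q s x =
      !![-g44 a b p q s x, 0, 0, 1; 0, 1, 0, 0; 0, 0, 1, 0; 1, 0, 0, 0] := by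
  rw [ginv, gmat_eq]
  refine Matrix.inv_eq_right_inv ?_
  ext i j
  fin_cases i <;> fin_cases j <;> simp [Matrix.mul_apply, Fin.sum_univ_four]

lemma pd_gmat (a b p q s : ℝ) (i j k : Fin 4) (x : Fin 4 → ℝ) :
    pd i (fun y => gmat a b p q s y j k) x =
      if j = 3 ∧ k = 3 then 2 * halfGrad a b p q s i x else 0 := by
  simp only [gmat_eq]
  fin_cases j <;> fin_cases k <;> simp [pd_const]
  exact pd_g44 a b p q s i x

/-- The Christoffel symbols are linear combinations of the halved gradient of `g₄₄`. -/
lemma Gam_eq (a b p q s : ℝ) (k i j : Fin 4) (x : Fin 4 → ℝ) :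
    Gam a b p q s k i j x =
      (if k = 0 ∧ j = 3 then 1 else 0) * halfGrad a b p q s i x
        + (if k = 0 ∧ i = 3 ∧ j ≠ 3 then 1 else 0) * halfGrad a b p q s j x
        - (if (k = 1 ∨ k = 2) ∧ i = 3 ∧ j = 3 then 1 else 0) * halfGrad a b p q s k x := by
  simp only [Gam, Fin.sum_univ_four, pd_gmat, ginv_eq]
  fin_cases k <;> fin_cases i <;> fin_cases j <;> simp [halfGrad]

lemma pd_Gam (a b p q s : ℝ) (l k i j : Fin 4) (x : Fin 4 → ℝ) :
    pd l (Gam a b p q s k i j) x =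
      (if k = 0 ∧ j = 3 then 1 else 0) * halfHess a b p q s x l i
        + (if k = 0 ∧ i = 3 ∧ j ≠ 3 then 1 else 0) * halfHess a b p q s x l j
        - (if (k = 1 ∨ k = 2) ∧ i = 3 ∧ j = 3 then 1 else 0) * halfHess a b p q s x l k := by
  have h := fun m => (differentiable_halfGrad a b p q s m).differentiableAt (x := x)
  rw [funext (Gam_eq a b p q s k i j)]
  simp only [sub_eq_add_neg, ← neg_mul]
  rw [pd_add _ (by fun_prop) (by fun_prop), pd_add _ (by fun_prop) (by fun_prop),
    pd_mul _ (by fun_prop) (h _), pd_mul _ (by fun_prop) (h _), pd_mul _ (by fun_prop) (h _)]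
  simp only [pd_const, pd_halfGrad, mul_zero, add_zero]

set_option maxHeartbeats 4000000 in
/-- The quadratic Christoffel terms cancel, so the curvature is linear in the Hessian of `g₄₄`. -/
lemma Riem_eq (a b p q s : ℝ) (i j k l : Fin 4) (x : Fin 4 → ℝ) :
    Riem a b p q s i j k l x =
      (if i = 0 ∧ (j = 1 ∨ j = 2) then 1 else 0) *
          ((if l = 3 ∧ k ≠ 3 then 1 else 0) * halfHess a b p q s x k j
            - (if k = 3 ∧ l ≠ 3 then 1 else 0) * halfHess a b p q s x l j)
        - (if (i = 1 ∨ i = 2) ∧ j = 3 then 1 else 0) *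
          ((if l = 3 ∧ k ≠ 3 then 1 else 0) * halfHess a b p q s x k i
            - (if k = 3 ∧ l ≠ 3 then 1 else 0) * halfHess a b p q s x l i) := by
  simp only [Riem, pd_Gam, Gam_eq, Fin.sum_univ_four]
  fin_cases i <;> fin_cases j <;> fin_cases k <;> fin_cases l <;>
    simp [halfHess, halfGrad]

lemma Ric_eq (a b p q s : ℝ) (j l : Fin 4) (x : Fin 4 → ℝ) :
    Ric a b p q s j l x =
      if j = 3 ∧ l = 3 then -((a + b) * x 3 + p + s) else 0 := by
  simp only [Ric, Riem_eq, Fin.sum_univ_four]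
  fin_cases j <;> fin_cases l <;> simp [halfHess]
  ring

lemma scal_eq (a b p q s : ℝ) (x : Fin 4 → ℝ) : scal a b p q s x = 0 := by
  simp [scal, Ric_eq, ginv_eq, Fin.sum_univ_four]

lemma Rlow_eq (a b p q s : ℝ) (i j k h : Fin 4) (x : Fin 4 → ℝ) :
    Rlow a b p q s i j k h x =
      (if i = 3 then 1 else 0) * Riem a b p q s 0 j k h x
        + (if i = 1 ∨ i = 2 then 1 else 0) * Riem a b p q s i j k h x := by
  simp only [Rlow, gmat_eq, Fin.sum_univ_four]
  fin_cases i <;> simp [Riem_eq]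

set_option maxHeartbeats 4000000 in
/-- the Weyl tensor has nonzero components (up to the curvature symmetries:
antisymmetry in each index pair and pair exchange) exactly
`W₂₄₂₄ = −W₃₄₃₄ = ((b − a)x⁴ + s − p)/2` and `W₂₄₃₄ = −q`; all components not obtained
from these by the curvature symmetries vanish.  Here `e m n i j` is the sign `±1` when
`(i,j)` equals `(m,n)` resp. `(n,m)`, and `0` otherwise. -/
theorem weyl_of_two_symmetric (a b p q s : ℝ) (x : Fin 4 → ℝ) (i j k h : Fin 4) :
    Weyl a b p q s i j k h x =
      (fun e : Fin 4 → Fin 4 → Fin 4 → Fin 4 → ℝ =>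
        e 1 3 i j * e 1 3 k h * (((b - a) * x 3 + s - p) / 2)
          - e 2 3 i j * e 2 3 k h * (((b - a) * x 3 + s - p) / 2)
          + (e 1 3 i j * e 2 3 k h + e 2 3 i j * e 1 3 k h) * (-q))
      (fun m n r t => if r = m ∧ t = n then 1 else if r = n ∧ t = m then -1 else 0) := by
  simp only [Weyl, Rlow_eq, Riem_eq, Ric_eq, scal_eq, gmat_eq]
  fin_cases i <;> fin_cases j <;> fin_cases k <;> fin_cases h <;>
    simp [halfHess] <;> ring
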